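/- For all r ≥ 0 and all n ≥ 1, as linear maps O(A)^(n) → O(A)^(n+r−1) one has 1̂^r ∘ π = π ∘ Ad((12)^{r,1}) ∘ 1̂^r, where (12)^{r,1} ∈ S(r+1) is the block permutation swapping the first block of size r with the following block of size 1 (i.e., the cycle sending r+1 to 1 and i to i+1 for 1 ≤ i ≤ r), regarded in S(n+r) as fixing all letters greater than r+1, and Ad(σ)(β) := σ·β·σ⁻¹ using the S(n+r)-bimodule structure on O(A)^(n+r). -/

import Mathlib

noncomputable section

set_option maxHeartbeats 1000000
set_option synthInstance.maxHeartbeats 100000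

open TensorProduct PiTensorProduct Equiv Function

variable (k : Type*) [Field k]
variable (A : Type*) [Ring A] [Algebra k A]

/-- The commutator subspace `[A,A] ⊆ A`. -/
def commSM : Submodule k A := Submodule.span k {x : A | ∃ a b : A, x = a * b - b * a}

/-- `A_♮ = A/[A,A]`. -/
abbrev Anat := A ⧸ commSM k A

/-- The quotient map `A → A_♮`. -/
def qNat : A →ₗ[k] Anat k A := (commSM k A).mkQ

/-- The symmetrizing relation on the tensor algebra of `A_♮`. -/
def symRel : TensorAlgebra k (Anat k A) → TensorAlgebra k (Anat k A) → Prop :=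
  fun u v => ∃ x y : TensorAlgebra k (Anat k A), u = x * y ∧ v = y * x

/-- The symmetric algebra `Sym(A_♮)`, realized as the quotient of the tensor algebra of `A_♮`
by the relations `xy = yx`. -/
abbrev SymA := RingQuot (symRel k A)

/-- The canonical inclusion `A_♮ → Sym(A_♮)`. -/
def iotaSym : Anat k A →ₗ[k] SymA k A :=
  (RingQuot.mkAlgHom k (symRel k A)).toLinearMap ∘ₗ TensorAlgebra.ι k

/-- Tensor powers of `A`. -/
abbrev TP (n : ℕ) := PiTensorProduct k (fun _ : Fin n => A)

/-- The group algebra `k[S(n)]`, as the free `k`-module on `S(n)`. -/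
abbrev GrpAlg (n : ℕ) := Equiv.Perm (Fin n) →₀ k

/-- The `n`-th graded component `O(A)^{(n)} = A^{⊗n} ⊗ Sym(A_♮) ⊗ k[S(n)]`. -/
abbrev OO (n : ℕ) := (TP k A n ⊗[k] SymA k A) ⊗[k] GrpAlg k n

/-- The pure element `(a_1 ⊗ ⋯ ⊗ a_n) ⊗ f ⊗ u` of `O(A)^{(n)}`. -/
def el {n : ℕ} (a : Fin n → A) (f : SymA k A) (u : Equiv.Perm (Fin n)) : OO k A n :=
  (tprod k a ⊗ₜ[k] f) ⊗ₜ[k] Finsupp.single u 1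

/-- Build a linear map out of `O(A)^{(n)}` from a family of linear maps on
`A^{⊗n} ⊗ Sym(A_♮)` indexed by permutations. -/
def build {n : ℕ} {M : Type*} [AddCommMonoid M] [Module k M]
    (F : Equiv.Perm (Fin n) → ((TP k A n ⊗[k] SymA k A) →ₗ[k] M)) :
    OO k A n →ₗ[k] M :=
  TensorProduct.lift
    ((Finsupp.lift ((TP k A n ⊗[k] SymA k A) →ₗ[k] M) k (Equiv.Perm (Fin n)) F).flip)

/-- Splitting off the first tensor factor. -/
def splitFirst (M : Type*) [AddCommGroup M] [Module k M] (n : ℕ) :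
    PiTensorProduct k (fun _ : Fin (n+1) => M) ≃ₗ[k]
      M ⊗[k] PiTensorProduct k (fun _ : Fin n => M) :=
  (PiTensorProduct.reindex k (fun _ : Fin (n+1) => M)
      ((finSumFinEquiv.trans (finCongr (by omega : 1 + n = n + 1))).symm :
        Fin (n+1) ≃ (Fin 1 ⊕ Fin n))).trans
    ((PiTensorProduct.tmulEquiv k M).symm.trans
      (TensorProduct.congr (PiTensorProduct.subsingletonEquiv (0 : Fin 1))
        (LinearEquiv.refl k _)))

/-- Left multiplication into the `s`-th factor of a tensor power of `A`:
`a₀ ⊗ (b_1 ⊗ ⋯ ⊗ b_n) ↦ b_1 ⊗ ⋯ ⊗ (a₀ * b_s) ⊗ ⋯ ⊗ b_n`. -/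
def mulInto : ∀ {n : ℕ}, Fin n → (A ⊗[k] TP k A n →ₗ[k] TP k A n)
  | 0, s => s.elim0
  | (m+1), s =>
    (PiTensorProduct.reindex k (fun _ : Fin (m+1) => A)
        (((Fin.cycleRange s)⁻¹ : Equiv.Perm (Fin (m+1))) : Fin (m+1) ≃ Fin (m+1))).toLinearMap ∘ₗ
    (splitFirst k A m).symm.toLinearMap ∘ₗ
    LinearMap.rTensor (TP k A m) (LinearMap.mul' k A) ∘ₗ
    (TensorProduct.assoc k A A (TP k A m)).symm.toLinearMap ∘ₗ
    LinearMap.lTensor A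
      (((PiTensorProduct.reindex k (fun _ : Fin (m+1) => A)
        ((Fin.cycleRange s : Equiv.Perm (Fin (m+1))) : Fin (m+1) ≃ Fin (m+1))).trans
        (splitFirst k A m)).toLinearMap)

/-- The embedding `S(n) → S(n+1)`, `w ↦ id_1 × w`. -/
def embedSucc {n : ℕ} (w : Equiv.Perm (Fin n)) : Equiv.Perm (Fin (n + 1)) :=
  ((finSuccEquiv n).symm).permCongr (Equiv.optionCongr w)

/-- The canonical projection `S(n+1) → S(n)`, `u ↦ u_*`. -/
def projSucc {n : ℕ} (u : Equiv.Perm (Fin (n + 1))) : Equiv.Perm (Fin n) :=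
  Equiv.removeNone (((finSuccEquiv n).symm.trans u).trans (finSuccEquiv n))

/-- Multiplication `A ⊗ Sym(A_♮) → Sym(A_♮)`, `a ⊗ f ↦ ā · f`. -/
def mulSym : A ⊗[k] SymA k A →ₗ[k] SymA k A :=
  LinearMap.mul' k (SymA k A) ∘ₗ
    LinearMap.rTensor (SymA k A) (iotaSym k A ∘ₗ qNat k A)

/-- Tensoring with a fixed group-algebra basis vector: `x ↦ x ⊗ u`. -/
def withPerm {n : ℕ} (u : Equiv.Perm (Fin n)) :
    (TP k A n ⊗[k] SymA k A) →ₗ[k] OO k A n :=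
  (TensorProduct.mk k (TP k A n ⊗[k] SymA k A) (GrpAlg k n)).flip (Finsupp.single u 1)

/-- The case `u(1) = 1` of `π`. -/
def piCaseOne {n : ℕ} (u : Equiv.Perm (Fin (n+1))) :
    (TP k A (n+1) ⊗[k] SymA k A) →ₗ[k] OO k A n :=
  withPerm k A (projSucc u) ∘ₗ
  LinearMap.lTensor (TP k A n) (mulSym k A) ∘ₗ
  (TensorProduct.leftComm k A (TP k A n) (SymA k A)).toLinearMap ∘ₗ
  (TensorProduct.assoc k A (TP k A n) (SymA k A)).toLinearMap ∘ₗ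
  LinearMap.rTensor (SymA k A) (splitFirst k A n).toLinearMap

/-- The case `u(1) = s > 1` of `π`. -/
def piCaseTwo {n : ℕ} (u : Equiv.Perm (Fin (n+1))) (h : u 0 ≠ 0) :
    (TP k A (n+1) ⊗[k] SymA k A) →ₗ[k] OO k A n :=
  withPerm k A (projSucc u) ∘ₗ
  LinearMap.rTensor (SymA k A) (mulInto k A ((u 0).pred h)) ∘ₗ
  LinearMap.rTensor (SymA k A) (splitFirst k A n).toLinearMap

/-- The map `π : O(A)^{(n+1)} → O(A)^{(n)}`. -/
def piMap {n : ℕ} : OO k A (n+1) →ₗ[k] OO k A n :=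
  build k A (fun u => if h : u 0 = 0 then piCaseOne k A u else piCaseTwo k A u h)

/-- Prepending a tensor factor `1`. -/
def consOne {n : ℕ} : TP k A n →ₗ[k] TP k A (n+1) :=
  (splitFirst k A n).symm.toLinearMap ∘ₗ TensorProduct.mk k A (TP k A n) 1

/-- The map `1̂ : O(A)^{(n)} → O(A)^{(n+1)}`. -/
def oneHat {n : ℕ} : OO k A n →ₗ[k] OO k A (n+1) :=
  build k A (fun u =>
    withPerm k A (embedSucc u) ∘ₗ LinearMap.rTensor (SymA k A) (consOne k A))

/-- The left action of `σ ∈ S(n)` on `O(A)^{(n)}`: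
`σ·((a_1⊗…⊗a_n)⊗f⊗τ) = (a_{σ⁻¹(1)}⊗…⊗a_{σ⁻¹(n)})⊗f⊗(στ)`. -/
def lAct {n : ℕ} (σ : Equiv.Perm (Fin n)) : OO k A n →ₗ[k] OO k A n :=
  build k A (fun u =>
    withPerm k A (σ * u) ∘ₗ
      LinearMap.rTensor (SymA k A)
        (PiTensorProduct.reindex k (fun _ : Fin n => A)
          (σ : Fin n ≃ Fin n)).toLinearMap)

/-- The right action of `σ ∈ S(n)` on `O(A)^{(n)}`:
`((a_1⊗…⊗a_n)⊗f⊗τ)·σ = (a_1⊗…⊗a_n)⊗f⊗(τσ)`. -/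
def rAct {n : ℕ} (σ : Equiv.Perm (Fin n)) : OO k A n →ₗ[k] OO k A n :=
  LinearMap.lTensor (TP k A n ⊗[k] SymA k A)
    (Finsupp.lmapDomain k k (fun u : Equiv.Perm (Fin n) => u * σ))

end

noncomputable section

variable (k : Type*) [Field k]
variable (A : Type*) [Ring A] [Algebra k A]

/-- The iterate `1̂^r : O(A)^{(m)} → O(A)^{(m+r)}`. -/
def iterOneHat (m : ℕ) : ∀ r : ℕ, OO k A m →ₗ[k] OO k A (m + r)
  | 0 => LinearMap.id
  | (r + 1) => oneHat k A ∘ₗ iterOneHat m r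

/-- Transport along an equality of degrees. -/
def castO {m m' : ℕ} (h : m = m') : OO k A m ≃ₗ[k] OO k A m' :=
  TensorProduct.congr
    (TensorProduct.congr
      (PiTensorProduct.reindex k (fun _ : Fin m => A) (finCongr h))
      (LinearEquiv.refl k (SymA k A)))
    (Finsupp.domLCongr ((finCongr h).permCongr))

/-- Conjugation `Ad(σ)(β) = σ·β·σ⁻¹` on `O(A)^{(m)}`. -/
def AdO {m : ℕ} (σ : Equiv.Perm (Fin m)) : OO k A m →ₗ[k] OO k A m :=
  lAct k A σ ∘ₗ rAct k A σ⁻¹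

section Helpers

open TensorProduct PiTensorProduct Equiv Function

variable {k A}

theorem build_el {n : ℕ} {M : Type*} [AddCommMonoid M] [Module k M]
    (F : Equiv.Perm (Fin n) → ((TP k A n ⊗[k] SymA k A) →ₗ[k] M))
    (a : Fin n → A) (f : SymA k A) (u : Equiv.Perm (Fin n)) :
    build k A F (el k A a f u) = F u (tprod k a ⊗ₜ[k] f) := by
  simp [build, el]

theorem OO_ext {n : ℕ} {M : Type*} [AddCommMonoid M] [Module k M]
    {F G : OO k A n →ₗ[k] M}
    (h : ∀ a f u, F (el k A a f u) = G (el k A a f u)) : F = G := by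
  apply TensorProduct.ext
  apply TensorProduct.ext
  apply PiTensorProduct.ext
  ext a : 1
  apply LinearMap.ext
  intro f
  apply Finsupp.lhom_ext'
  intro u
  apply LinearMap.ext_ring
  exact h a f u

theorem withPerm_tmul {n : ℕ} (u : Equiv.Perm (Fin n)) (a : Fin n → A) (f : SymA k A) :
    withPerm k A u (tprod k a ⊗ₜ[k] f) = el k A a f u := rfl

theorem splitFirst_tprod (n : ℕ) (a : Fin (n+1) → A) :
    splitFirst k A n (tprod k a) = a 0 ⊗ₜ[k] tprod k (fun i : Fin n => a i.succ) := by
  unfold splitFirst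
  simp only [LinearEquiv.trans_apply]
  erw [PiTensorProduct.reindex_tprod]
  erw [PiTensorProduct.tmulEquiv_symm_apply]
  rw [TensorProduct.congr_tmul]
  erw [PiTensorProduct.subsingletonEquiv_apply_tprod]
  simp only [LinearEquiv.refl_apply]
  congr 2
  funext i
  congr 1
  ext
  simp

theorem splitFirst_symm_tmul (n : ℕ) (x : A) (b : Fin n → A) :
    (splitFirst k A n).symm (x ⊗ₜ[k] tprod k b) = tprod k (Fin.cons x b : Fin (n+1) → A) := by
  rw [LinearEquiv.symm_apply_eq, splitFirst_tprod]
  simp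

theorem mulInto_tmul {n : ℕ} (s : Fin n) (x : A) (b : Fin n → A) :
    mulInto k A s (x ⊗ₜ[k] tprod k b) = tprod k (Function.update b s (x * b s)) := by
  cases n with
  | zero => exact s.elim0
  | succ m =>
    simp only [mulInto, LinearMap.comp_apply, LinearMap.lTensor_tmul, LinearEquiv.coe_coe,
      LinearEquiv.trans_apply]
    erw [PiTensorProduct.reindex_tprod]
    rw [splitFirst_tprod]
    simp only [TensorProduct.assoc_symm_tmul, LinearMap.rTensor_tmul, LinearMap.mul'_apply]
    rw [splitFirst_symm_tmul]
    erw [PiTensorProduct.reindex_tprod]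
    congr 1
    funext i
    have : ((Fin.cycleRange s)⁻¹ : Equiv.Perm (Fin (m+1))).symm = Fin.cycleRange s := rfl
    rw [this, Fin.cons_apply_cycleRange]
    simp only [Fin.cycleRange_symm_zero, Fin.cycleRange_symm_succ]
    by_cases h : i = s
    · subst h; simp
    · obtain ⟨j, rfl⟩ := Fin.exists_succAbove_eq h
      simp

theorem oneHat_el {n : ℕ} (a : Fin n → A) (f : SymA k A) (u : Equiv.Perm (Fin n)) :
    oneHat k A (el k A a f u) = el k A (Fin.cons 1 a : Fin (n+1) → A) f (embedSucc u) := by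
  rw [oneHat, build_el]
  simp only [LinearMap.comp_apply, LinearMap.rTensor_tmul, consOne, LinearEquiv.coe_coe,
    TensorProduct.mk_apply]
  rw [splitFirst_symm_tmul, withPerm_tmul]

theorem lAct_el {n : ℕ} (σ : Equiv.Perm (Fin n)) (a : Fin n → A) (f : SymA k A)
    (u : Equiv.Perm (Fin n)) :
    lAct k A σ (el k A a f u) = el k A (fun i => a (σ.symm i)) f (σ * u) := by
  rw [lAct, build_el]
  simp only [LinearMap.comp_apply, LinearMap.rTensor_tmul, LinearEquiv.coe_coe]
  erw [PiTensorProduct.reindex_tprod]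
  rw [withPerm_tmul]

theorem rAct_el {n : ℕ} (σ : Equiv.Perm (Fin n)) (a : Fin n → A) (f : SymA k A)
    (u : Equiv.Perm (Fin n)) :
    rAct k A σ (el k A a f u) = el k A a f (u * σ) := by
  simp [rAct, el, Finsupp.mapDomain_single]

theorem castO_el {m m' : ℕ} (h : m = m') (a : Fin m → A) (f : SymA k A)
    (u : Equiv.Perm (Fin m)) :
    castO k A h (el k A a f u) =
      el k A (fun i => a (Fin.cast h.symm i)) f ((finCongr h).permCongr u) := by
  simp only [castO, el, TensorProduct.congr_tmul, LinearEquiv.refl_apply]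
  erw [PiTensorProduct.reindex_tprod]
  rw [Finsupp.domLCongr_single]
  rfl

theorem piMap_el_one {n : ℕ} (a : Fin (n+1) → A) (f : SymA k A)
    (u : Equiv.Perm (Fin (n+1))) (h : u 0 = 0) :
    piMap k A (el k A a f u) =
      el k A (fun i => a i.succ) (iotaSym k A (qNat k A (a 0)) * f) (projSucc u) := by
  rw [piMap, build_el, dif_pos h]
  simp only [piCaseOne, LinearMap.comp_apply, LinearMap.rTensor_tmul, LinearEquiv.coe_coe]
  rw [splitFirst_tprod]
  simp only [TensorProduct.assoc_tmul, TensorProduct.leftComm_tmul, LinearMap.lTensor_tmul]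
  rw [withPerm_tmul]
  simp [mulSym]

theorem piMap_el_two {n : ℕ} (a : Fin (n+1) → A) (f : SymA k A)
    (u : Equiv.Perm (Fin (n+1))) (h : u 0 ≠ 0) :
    piMap k A (el k A a f u) =
      el k A (Function.update (fun i : Fin n => a i.succ) ((u 0).pred h) (a 0 * a (u 0)))
        f (projSucc u) := by
  rw [piMap, build_el, dif_neg h]
  simp only [piCaseTwo, LinearMap.comp_apply, LinearMap.rTensor_tmul, LinearEquiv.coe_coe]
  rw [splitFirst_tprod, mulInto_tmul, withPerm_tmul]
  simp

/-- `r`-fold prepending of `1`. -/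
def consIter {m : ℕ} (a : Fin m → A) : ∀ r : ℕ, Fin (m + r) → A
  | 0 => a
  | (r+1) => (Fin.cons 1 (consIter a r) : Fin (m + r + 1) → A)

/-- `r`-fold iterate of `embedSucc`. -/
def embedIter {m : ℕ} (u : Equiv.Perm (Fin m)) : ∀ r : ℕ, Equiv.Perm (Fin (m + r))
  | 0 => u
  | (r+1) => embedSucc (embedIter u r)

theorem iterOneHat_el {m : ℕ} (r : ℕ) (a : Fin m → A) (f : SymA k A)
    (u : Equiv.Perm (Fin m)) :
    iterOneHat k A m r (el k A a f u) = el k A (consIter a r) f (embedIter u r) := by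
  induction r with
  | zero => rfl
  | succ r ih =>
    simp only [iterOneHat, LinearMap.comp_apply, ih, oneHat_el]
    rfl

theorem consIter_lt {m r : ℕ} (a : Fin m → A) (i : Fin (m + r)) (h : i.val < r) :
    consIter a r i = 1 := by
  induction r with
  | zero => omega
  | succ r ih =>
    obtain rfl | ⟨j, rfl⟩ := Fin.eq_zero_or_eq_succ (n := m + r) i
    · rfl
    · exact ih j (by simpa using h)

theorem consIter_ge {m r : ℕ} (a : Fin m → A) (i : Fin (m + r)) (j : Fin m)
    (h : i.val = j.val + r) : consIter a r i = a j := by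
  induction r with
  | zero => exact congrArg a (Fin.ext h)
  | succ r ih =>
    obtain rfl | ⟨j', rfl⟩ := Fin.eq_zero_or_eq_succ (n := m + r) i
    · simp at h
    · exact ih j' (by simp at h; omega)

theorem embedSucc_zero {m : ℕ} (u : Equiv.Perm (Fin m)) : embedSucc u 0 = 0 := by
  simp [embedSucc]

theorem embedSucc_succ {m : ℕ} (u : Equiv.Perm (Fin m)) (i : Fin m) :
    embedSucc u i.succ = (u i).succ := by
  simp [embedSucc]

theorem embedIter_lt {m r : ℕ} (u : Equiv.Perm (Fin m)) (i : Fin (m + r)) (h : i.val < r) :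
    embedIter u r i = i := by
  induction r with
  | zero => omega
  | succ r ih =>
    obtain rfl | ⟨j, rfl⟩ := Fin.eq_zero_or_eq_succ (n := m + r) i
    · exact embedSucc_zero _
    · exact (embedSucc_succ _ _).trans (congrArg Fin.succ (ih j (by simpa using h)))

theorem embedIter_ge {m r : ℕ} (u : Equiv.Perm (Fin m)) (i : Fin (m + r)) (j : Fin m)
    (h : i.val = j.val + r) : (embedIter u r i).val = (u j).val + r := by
  induction r with
  | zero =>
    have : i = j := Fin.ext h
    subst this; rfl
  | succ r ih =>
    obtain rfl | ⟨j', rfl⟩ := Fin.eq_zero_or_eq_succ (n := m + r) i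
    · simp at h
    · have := ih j' (by simp at h; omega)
      have h2 := congrArg Fin.val (embedSucc_succ (embedIter u r) j')
      change (embedSucc (embedIter u r) j'.succ).val = _
      rw [h2, Fin.val_succ, this]; omega

theorem projSucc_ne {n : ℕ} (u : Equiv.Perm (Fin (n+1))) (i : Fin n) (h : u i.succ ≠ 0) :
    (projSucc u i).succ = u i.succ := by
  have := Equiv.removeNone_some (((finSuccEquiv n).symm.trans u).trans (finSuccEquiv n))
    (x := i) ⟨(u i.succ).pred h, by
      obtain ⟨j, hj⟩ := Fin.exists_succ_eq.2 h
      simp [← hj]⟩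
  have h2 := congrArg (finSuccEquiv n).symm this
  simpa [projSucc] using h2

theorem projSucc_eq {n : ℕ} (u : Equiv.Perm (Fin (n+1))) (i : Fin n) (h : u i.succ = 0) :
    (projSucc u i).succ = u 0 := by
  have := Equiv.removeNone_none (((finSuccEquiv n).symm.trans u).trans (finSuccEquiv n))
    (x := i) (by simp [h])
  have h2 := congrArg (finSuccEquiv n).symm this
  simpa [projSucc] using h2

/-- Inverse cycle at `0`. -/
theorem cyc_symm_zero {N r : ℕ} (h : r < N + 1) :
    (Fin.cycleRange (⟨r, h⟩ : Fin (N+1))).symm 0 = ⟨r, h⟩ := by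
  simp

/-- Inverse cycle at a successor. -/
theorem cyc_symm_succ {N r : ℕ} (h : r < N + 1) (i : Fin N) :
    ((Fin.cycleRange (⟨r, h⟩ : Fin (N+1))).symm i.succ).val =
      if i.val < r then i.val else i.val + 1 := by
  rw [Fin.cycleRange_symm_succ]
  simp only [Fin.succAbove, Fin.lt_def, Fin.val_castSucc]
  split_ifs <;> simp

theorem cyc_val {N r : ℕ} (h : r < N + 1) (i : Fin (N+1)) :
    ((Fin.cycleRange (⟨r, h⟩ : Fin (N+1))) i).val =
      if i.val < r then i.val + 1 else if i.val = r then 0 else i.val := by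
  split_ifs with h1 h2
  · exact Fin.coe_cycleRange_of_lt h1
  · have : i = ⟨r, h⟩ := Fin.ext h2
    subst this; simp
  · rw [Fin.cycleRange_of_gt]
    simp only [Fin.lt_def]; omega

theorem lt_aux (n r : ℕ) : r < n + r + 1 := by omega

theorem eq_aux (n r : ℕ) : (n + 1) + r = (n + r) + 1 := by omega

/-- The conjugated permutation. -/
def conjPerm {n : ℕ} (r : ℕ) (u : Equiv.Perm (Fin (n+1))) : Equiv.Perm (Fin ((n + r) + 1)) :=
  Fin.cycleRange (⟨r, lt_aux n r⟩ : Fin ((n + r) + 1)) *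
    ((finCongr (eq_aux n r)).permCongr (embedIter u r) *
      (Fin.cycleRange (⟨r, lt_aux n r⟩ : Fin ((n + r) + 1)))⁻¹)

theorem conjPerm_val {n : ℕ} (r : ℕ) (u : Equiv.Perm (Fin (n+1))) (i : Fin ((n + r) + 1)) :
    (conjPerm r u i).val =
      (Fin.cycleRange (⟨r, lt_aux n r⟩ : Fin ((n + r) + 1))
        (Fin.cast (eq_aux n r) (embedIter u r (Fin.cast (eq_aux n r).symm
          ((Fin.cycleRange (⟨r, lt_aux n r⟩ : Fin ((n + r) + 1))).symm i))))).val := rfl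

theorem conjPerm_zero {n : ℕ} (r : ℕ) (u : Equiv.Perm (Fin (n+1))) :
    (conjPerm r u 0).val = if u 0 = 0 then 0 else (u 0).val + r := by
  rw [conjPerm_val, cyc_val, cyc_symm_zero]
  have := embedIter_ge u (Fin.cast (eq_aux n r).symm (⟨r, lt_aux n r⟩ : Fin ((n + r) + 1))) 0
    (r := r) (by simp)
  simp only [Fin.val_cast, this, Fin.ext_iff, Fin.val_zero]
  split_ifs <;> omega

theorem conjPerm_succ_lt {n : ℕ} (r : ℕ) (u : Equiv.Perm (Fin (n+1))) (i : Fin (n + r))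
    (h : i.val < r) : (conjPerm r u i.succ).val = i.val + 1 := by
  have h1 := cyc_symm_succ (N := n + r) (r := r) (lt_aux n r) i
  rw [if_pos h] at h1
  rw [conjPerm_val, cyc_val, embedIter_lt _ _ (by rw [Fin.val_cast, h1]; exact h)]
  simp only [Fin.val_cast, h1]
  rw [if_pos h]

theorem conjPerm_succ_ge {n : ℕ} (r : ℕ) (u : Equiv.Perm (Fin (n+1))) (i : Fin (n + r))
    (j : Fin n) (h : i.val = j.val + r) :
    (conjPerm r u i.succ).val = if u j.succ = 0 then 0 else (u j.succ).val + r := by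
  have h1 := cyc_symm_succ (N := n + r) (r := r) (lt_aux n r) i
  rw [if_neg (by omega)] at h1
  have := embedIter_ge u (Fin.cast (eq_aux n r).symm
    ((Fin.cycleRange (⟨r, lt_aux n r⟩ : Fin ((n + r) + 1))).symm i.succ)) j.succ
    (r := r) (by rw [Fin.val_cast, h1, h, Fin.val_succ]; omega)
  rw [conjPerm_val, cyc_val]
  simp only [Fin.val_cast, this, Fin.ext_iff, Fin.val_zero]
  split_ifs <;> omega

theorem projSucc_conjPerm {n : ℕ} (r : ℕ) (u : Equiv.Perm (Fin (n+1))) :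
    projSucc (conjPerm r u) = embedIter (projSucc u) r := by
  ext i
  by_cases h : i.val < r
  · have h1 := conjPerm_succ_lt r u i h
    have h2 := congrArg Fin.val (projSucc_ne (conjPerm r u) i (by
      intro h0; rw [h0] at h1; simp at h1))
    rw [embedIter_lt _ _ h]
    rw [h1, Fin.val_succ] at h2
    omega
  · have hj : i.val = (⟨i.val - r, by omega⟩ : Fin n).val + r := by simp; omega
    generalize (⟨i.val - r, by omega⟩ : Fin n) = j at hj
    rw [embedIter_ge _ _ j hj]
    have h1 := conjPerm_succ_ge r u i j hj
    by_cases h0 : u j.succ = 0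
    · rw [if_pos h0] at h1
      have h2 := congrArg Fin.val (projSucc_eq (conjPerm r u) i (Fin.ext h1))
      have h3 := congrArg Fin.val (projSucc_eq u j h0)
      have h4 : u 0 ≠ 0 := by
        intro h5
        exact absurd (u.injective (h0.trans h5.symm)) (Fin.succ_ne_zero j)
      rw [conjPerm_zero, if_neg h4, Fin.val_succ, ← h3, Fin.val_succ] at h2
      omega
    · rw [if_neg h0] at h1
      have h3 := congrArg Fin.val (projSucc_ne u j h0)
      have h2 := congrArg Fin.val (projSucc_ne (conjPerm r u) i (by
        intro h5
        rw [h5, ← h3] at h1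
        simp at h1
        omega))
      rw [h1, Fin.val_succ, ← h3, Fin.val_succ] at h2
      omega

/-- The conjugated tensor. -/
def conjVec {n : ℕ} (r : ℕ) (a : Fin (n+1) → A) : Fin ((n + r) + 1) → A :=
  fun i => consIter a r (Fin.cast (eq_aux n r).symm
    ((Fin.cycleRange (⟨r, lt_aux n r⟩ : Fin ((n + r) + 1))).symm i))

theorem conjVec_zero {n : ℕ} (r : ℕ) (a : Fin (n+1) → A) : conjVec r a 0 = a 0 := by
  rw [conjVec, cyc_symm_zero]
  exact consIter_ge _ _ _ (by simp)

theorem conjVec_succ {n : ℕ} (r : ℕ) (a : Fin (n+1) → A) (i : Fin (n + r)) :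
    conjVec r a i.succ = consIter (fun j : Fin n => a j.succ) r i := by
  have h1 := cyc_symm_succ (N := n + r) (r := r) (lt_aux n r) i
  rw [conjVec]
  by_cases h : i.val < r
  · rw [if_pos h] at h1
    rw [consIter_lt _ _ h, consIter_lt _ _ (by rw [Fin.val_cast, h1]; exact h)]
  · rw [if_neg h] at h1
    have hj : i.val = (⟨i.val - r, by omega⟩ : Fin n).val + r := by simp; omega
    rw [consIter_ge _ i _ hj]
    exact consIter_ge _ _ _ (by rw [Fin.val_cast, h1, Fin.val_succ]; omega)

theorem consIter_update {m r : ℕ} (b : Fin m → A) (s : Fin m) (x : A) (t : Fin (m + r))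
    (ht : t.val = s.val + r) :
    consIter (Function.update b s x) r = Function.update (consIter b r) t x := by
  funext i
  by_cases h : i.val < r
  · rw [consIter_lt _ _ h, Function.update_of_ne (by intro h2; subst h2; omega),
      consIter_lt _ _ h]
  · have hj : i.val = (⟨i.val - r, by omega⟩ : Fin m).val + r := by simp; omega
    generalize (⟨i.val - r, by omega⟩ : Fin m) = j at hj
    rw [consIter_ge _ i _ hj]
    by_cases hs : j = s
    · subst hs
      have : i = t := Fin.ext (by omega)
      subst this; simp
    · rw [Function.update_of_ne hs, Function.update_of_ne, consIter_ge _ i _ hj]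
      intro h2; subst h2; exact hs (Fin.ext (by omega))

theorem main_el {n : ℕ} (r : ℕ) (a : Fin (n+1) → A) (f : SymA k A)
    (u : Equiv.Perm (Fin (n+1))) :
    iterOneHat k A n r (piMap k A (el k A a f u)) =
      piMap k A (el k A (conjVec r a) f (conjPerm r u)) := by
  have hz := conjPerm_zero r u
  by_cases h : u 0 = 0
  · rw [if_pos h] at hz
    rw [piMap_el_one _ _ _ h, piMap_el_one _ _ _ (Fin.ext hz), iterOneHat_el,
      projSucc_conjPerm, conjVec_zero]
    simp only [conjVec_succ]
  · rw [if_neg h] at hz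
    have hu : (u 0).val ≠ 0 := fun h0 => h (Fin.ext h0)
    have hz' : conjPerm r u 0 ≠ 0 := by
      intro h0; rw [h0] at hz; simp at hz; omega
    rw [piMap_el_two _ _ _ h, piMap_el_two _ _ _ hz', iterOneHat_el,
      projSucc_conjPerm, conjVec_zero]
    simp only [conjVec_succ]
    have hp : ((conjPerm r u 0).pred hz').val = ((u 0).pred h).val + r := by
      simp only [Fin.val_pred, hz]; omega
    rw [consIter_update _ _ _ _ hp]
    have : conjVec r a (conjPerm r u 0) = a (u 0) := by
      conv_lhs => rw [← Fin.succ_pred _ hz']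
      rw [conjVec_succ, consIter_ge _ _ _ hp, Fin.succ_pred]
    rw [this]

end Helpers

/-!
Statement 7: for all `r ≥ 0`, `n ≥ 1`, as linear maps `O(A)^{(n)} → O(A)^{(n+r-1)}`:
`1̂^r ∘ π = π ∘ Ad((12)^{r,1}) ∘ 1̂^r`, where `(12)^{r,1} ∈ S(r+1) ⊆ S(n+r)` is the block
permutation swapping the first block of size `r` with the following block of size `1`
(0-indexed: `i ↦ i+1` for `i < r`, `r ↦ 0`, and fixing everything else, i.e.
`Fin.cycleRange r`).  We parametrize the domain degree as `n + 1`.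
-/

theorem iterOneHat_piMap_comm
    (kk : Type*) [Field kk] [IsAlgClosed kk] [CharZero kk]
    (A : Type*) [Ring A] [Algebra kk A] (n r : ℕ) :
    iterOneHat kk A n r ∘ₗ piMap kk A =
      piMap kk A ∘ₗ
        AdO kk A (Fin.cycleRange (⟨r, by omega⟩ : Fin ((n + r) + 1))) ∘ₗ
        (castO kk A (by omega : (n + 1) + r = (n + r) + 1)).toLinearMap ∘ₗ
        iterOneHat kk A (n + 1) r := by
  apply OO_ext
  intro a f u
  simp only [LinearMap.comp_apply, LinearEquiv.coe_coe, AdO]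
  rw [iterOneHat_el, castO_el, rAct_el, lAct_el, main_el]
  rfl

end
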